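/- arXiv:2008.09235 — 2 statements merged into one kernel-verified Lean document; each statement's English description precedes it below -/
import Mathlib

section
/- Let p be a positive integer, T₁ > 0 and ε > 0. Let f : SL(2,ℝ) → ℂ be measurable, square-integrable on compact sets, with f(x n_p) = f(x) and |f(x w)| = |f(x)| for all x ∈ SL(2,ℝ). Then, as inequalities in [0,∞]: ∫₀^{2π} ∫₀^{1} (a^{2+ε} + a^{2−ε}) ⌊T₁/(p a²)⌋ (∫₀^{p} |f(k_θ d_a n_t)|² dt) da/a dθ ≤ ‖f‖²_{T₁,ε} and ‖f‖²_{T₁,ε} ≤ ∫₀^{2π} ∫₀^{1} a^{2+ε} (⌊T₁/(p a²)⌋ + 1) (∫₀^{p} |f(k_θ d_a n_t)|² dt) da/a dθ + (T₁²+1)^{ε/2} ∫₀^{2π} ∫₀^{√(T₁²+1)} a^{2−ε} (⌊T₁/(p a²)⌋ + 1) (∫₀^{p} |f(k_θ d_a n_t)|² dt) da/a dθ. -/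
open MeasureTheory Real Set
open scoped ENNReal NNReal

noncomputable section

abbrev SL2 := Matrix.SpecialLinearGroup (Fin 2) ℝ

instance : TopologicalSpace SL2 :=
  inferInstanceAs (TopologicalSpace {A : Matrix (Fin 2) (Fin 2) ℝ // A.det = 1})
instance : MeasurableSpace SL2 := borel SL2

def kRot (θ : ℝ) : SL2 :=
  ⟨!![Real.cos θ, -Real.sin θ; Real.sin θ, Real.cos θ], by
    simp [Matrix.det_fin_two_of]
    nlinarith [Real.sin_sq_add_cos_sq θ]⟩

def dMat (a : ℝ) : SL2 :=
  if h : a ≠ 0 then ⟨!![a, 0; 0, a⁻¹], by simp [Matrix.det_fin_two_of, mul_inv_cancel₀ h]⟩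
  else 1

def nMat (t : ℝ) : SL2 := ⟨!![1, t; 0, 1], by simp [Matrix.det_fin_two_of]⟩

def wMat : SL2 := ⟨!![0, 1; -1, 0], by simp [Matrix.det_fin_two_of]⟩

def LocSqInt (f : SL2 → ℂ) : Prop :=
  ∀ K : Set (ℝ × ℝ × ℝ), IsCompact K → K ⊆ {q | 0 < q.2.2} →
    IntegrableOn (fun q : ℝ × ℝ × ℝ => ‖f (kRot q.1 * nMat q.2.1 * dMat q.2.2)‖ ^ 2) K volume

/-- `‖f‖²_{T₁,ε} = ∫₀^{2π} ∫₀^∞ ∫₀^{T₁} |f(k_θ n_T d_a)|² a^ε dT (da/a) dθ`. -/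
def normXSq (f : SL2 → ℂ) (T₁ ε : ℝ) : ℝ≥0∞ :=
  ∫⁻ θ in Ioc (0:ℝ) (2 * π), ∫⁻ a in Ioi (0:ℝ),
    (∫⁻ T in Ioc (0:ℝ) T₁,
      (‖f (kRot θ * nMat T * dMat a)‖₊ : ℝ≥0∞) ^ 2 * ENNReal.ofReal (a ^ ε))
      * ENNReal.ofReal a⁻¹

theorem measurable_SL2_of_entries {α : Type*} [MeasurableSpace α] {g : α → SL2}
    (h : ∀ i j, Measurable fun x => (g x).1 i j) : Measurable g := by
  let S := {A : Fin 2 → Fin 2 → ℝ // Matrix.det (Matrix.of A) = 1}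
  have e : @Measurable α S _ (borel S) fun x => ⟨fun i j => (g x).1 i j, (g x).2⟩ := by
    rw [← (inferInstance : BorelSpace S).measurable_eq]
    exact (measurable_pi_lambda _ fun i => measurable_pi_lambda _ fun j => h i j).subtype_mk
  exact e

theorem coe_kRot (θ : ℝ) : (kRot θ).1 = !![cos θ, -sin θ; sin θ, cos θ] := rfl

theorem coe_nMat (t : ℝ) : (nMat t).1 = !![1, t; 0, 1] := rfl

theorem coe_wMat : wMat.1 = !![0, 1; -1, 0] := rfl

theorem coe_dMat {a : ℝ} (ha : a ≠ 0) : (dMat a).1 = !![a, 0; 0, a⁻¹] :=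
  congrArg (fun x : SL2 => x.1) (dif_pos ha)

theorem measurable_kRot_mul_nMat_mul_dMat :
    Measurable fun q : ℝ × ℝ × ℝ => kRot q.1 * nMat q.2.1 * dMat q.2.2 := by
  have hd : ∀ i j, Measurable fun a : ℝ => (dMat a).1 i j := by
    intro i j
    have : (fun a : ℝ => (dMat a).1 i j) = fun a : ℝ =>
        if a = 0 then (1 : Matrix (Fin 2) (Fin 2) ℝ) i j
        else (!![a, 0; 0, a⁻¹] : Matrix (Fin 2) (Fin 2) ℝ) i j := by
      funext a
      split_ifs with h
      · exact congrArg (fun x : SL2 => x.1 i j) (dif_neg (not_not.2 h))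
      · rw [coe_dMat h]
    rw [this]
    refine Measurable.ite (measurableSet_singleton (0 : ℝ)) measurable_const ?_
    fin_cases i <;> fin_cases j <;> simp <;> fun_prop
  have hn : ∀ i j, Measurable fun a : ℝ => (nMat a).1 i j := by
    intro i j
    fin_cases i <;> fin_cases j <;> simp [coe_nMat]
    fun_prop
  have hk : ∀ i j, Measurable fun a : ℝ => (kRot a).1 i j := by
    intro i j
    fin_cases i <;> fin_cases j <;> simp [coe_kRot] <;> fun_prop
  refine measurable_SL2_of_entries fun i j => ?_
  have e : ∀ x y z : SL2, (x * y * z).1 i j = (x.1 i 0 * y.1 0 0 + x.1 i 1 * y.1 1 0) * z.1 0 j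
      + (x.1 i 0 * y.1 0 1 + x.1 i 1 * y.1 1 1) * z.1 1 j := fun x y z => by
    rw [Matrix.SpecialLinearGroup.coe_mul, Matrix.SpecialLinearGroup.coe_mul]
    simp only [Matrix.mul_apply, Fin.sum_univ_two]
  simp only [e]
  have hd' := fun i j => (hd i j).comp (f := fun q : ℝ × ℝ × ℝ => q.2.2) (by fun_prop)
  have hn' := fun i j => (hn i j).comp (f := fun q : ℝ × ℝ × ℝ => q.2.1) (by fun_prop)
  have hk' := fun i j => (hk i j).comp (f := fun q : ℝ × ℝ × ℝ => q.1) (by fun_prop)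
  exact ((((hk' i 0).mul (hn' 0 0)).add ((hk' i 1).mul (hn' 1 0))).mul (hd' 0 j)).add
    ((((hk' i 0).mul (hn' 0 1)).add ((hk' i 1).mul (hn' 1 1))).mul (hd' 1 j))

theorem nMat_mul_dMat {a : ℝ} (ha : a ≠ 0) (T : ℝ) :
    nMat T * dMat a = dMat a * nMat (T / a ^ 2) := by
  refine Subtype.ext ?_
  rw [Matrix.SpecialLinearGroup.coe_mul, Matrix.SpecialLinearGroup.coe_mul, coe_dMat ha,
    coe_nMat, coe_nMat, Matrix.mul_fin_two, Matrix.mul_fin_two]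
  ext i j
  fin_cases i <;> fin_cases j <;> simp
  field_simp

theorem nMat_mul_nMat (s t : ℝ) : nMat s * nMat t = nMat (s + t) := by
  refine Subtype.ext ?_
  rw [Matrix.SpecialLinearGroup.coe_mul, coe_nMat, coe_nMat, coe_nMat, Matrix.mul_fin_two]
  simp [add_comm]

theorem kRot_mul_kRot (s t : ℝ) : kRot s * kRot t = kRot (s + t) := by
  refine Subtype.ext ?_
  rw [Matrix.SpecialLinearGroup.coe_mul, coe_kRot, coe_kRot, coe_kRot, Matrix.mul_fin_two,
    cos_add, sin_add]
  ext i j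
  fin_cases i <;> fin_cases j <;> simp <;> ring

theorem kRot_periodic : Function.Periodic kRot (2 * π) := fun θ => by
  refine Subtype.ext ?_
  rw [coe_kRot, coe_kRot, cos_add_two_pi, sin_add_two_pi]

theorem exists_nMat_mul_dMat_mul_wMat (T : ℝ) :
    ∃ φ : ℝ, ∀ a : ℝ, 0 < a →
      nMat T * dMat a * wMat = kRot φ * nMat (-T) * dMat (√(T ^ 2 + 1) / a) := by
  have hs : 0 < √(T ^ 2 + 1) := by positivity
  have hs2 : √(T ^ 2 + 1) ^ 2 = T ^ 2 + 1 := Real.sq_sqrt (by positivity)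
  have hz : ‖(⟨-T, -1⟩ : ℂ)‖ = √(T ^ 2 + 1) := by
    rw [Complex.norm_def, Complex.normSq_apply]
    congr 1
    ring
  set s := √(T ^ 2 + 1)
  have hc : cos (Complex.arg ⟨-T, -1⟩) = -T / s := by
    rw [Complex.cos_arg, hz]
    intro h
    simpa using congrArg Complex.im h
  have hsin : sin (Complex.arg ⟨-T, -1⟩) = -1 / s := by
    rw [Complex.sin_arg, hz]
  refine ⟨Complex.arg ⟨-T, -1⟩, fun a ha => Subtype.ext ?_⟩
  have hsa : s / a ≠ 0 := by positivity
  rw [Matrix.SpecialLinearGroup.coe_mul, Matrix.SpecialLinearGroup.coe_mul,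
    Matrix.SpecialLinearGroup.coe_mul, Matrix.SpecialLinearGroup.coe_mul, coe_dMat ha.ne',
    coe_dMat hsa, coe_nMat, coe_nMat, coe_kRot, coe_wMat, hc, hsin]
  simp only [Matrix.mul_fin_two]
  ext i j
  fin_cases i <;> fin_cases j <;> simp
  · field_simp
  · field_simp
    linear_combination hs2
  · field_simp
  · left
    ring

theorem setLIntegral_Ioc_add_eq_of_periodic {h : ℝ → ℝ≥0∞} {P : ℝ} (hP : 0 < P)
    (hh : Function.Periodic h P) (c d : ℝ) :
    ∫⁻ t in Ioc c (c + P), h t = ∫⁻ t in Ioc d (d + P), h t := by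
  refine (isAddFundamentalDomain_Ioc hP c).setLIntegral_eq (isAddFundamentalDomain_Ioc hP d) h ?_
  rintro ⟨g, hg⟩ x
  obtain ⟨n, rfl⟩ := AddSubgroup.mem_zmultiples_iff.1 hg
  show h (n • P + x) = h x
  rw [add_comm]
  exact hh.zsmul n x

theorem setLIntegral_Ioc_nat_mul_of_periodic {h : ℝ → ℝ≥0∞} {P : ℝ} (hP : 0 < P)
    (hh : Function.Periodic h P) (N : ℕ) :
    ∫⁻ t in Ioc 0 (N * P), h t = N * ∫⁻ t in Ioc 0 P, h t := by
  induction N with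
  | zero => simp
  | succ n ih =>
    have h1 : (0 : ℝ) ≤ n * P := by positivity
    have h2 : (n : ℝ) * P ≤ n * P + P := by linarith
    have h3 := setLIntegral_Ioc_add_eq_of_periodic hP hh (n * P) 0
    rw [zero_add] at h3
    rw [show ((n + 1 : ℕ) : ℝ) * P = n * P + P by push_cast; ring, ← Ioc_union_Ioc_eq_Ioc h1 h2,
      lintegral_union measurableSet_Ioc (Ioc_disjoint_Ioc_of_le le_rfl), ih, h3]
    push_cast
    ring

theorem floor_mul_le_setLIntegral_of_periodic {h : ℝ → ℝ≥0∞} {P : ℝ} (hP : 0 < P)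
    (hh : Function.Periodic h P) {R : ℝ} (hR : 0 ≤ R) :
    ENNReal.ofReal ⌊R / P⌋ * (∫⁻ t in Ioc 0 P, h t) ≤ ∫⁻ t in Ioc 0 R, h t := by
  have h0 : 0 ≤ R / P := by positivity
  rw [← natCast_floor_eq_intCast_floor h0, ENNReal.ofReal_natCast,
    ← setLIntegral_Ioc_nat_mul_of_periodic hP hh]
  refine lintegral_mono_set (Ioc_subset_Ioc_right ?_)
  rw [← le_div_iff₀ hP]
  exact Nat.floor_le h0

theorem setLIntegral_le_floor_mul_of_periodic {h : ℝ → ℝ≥0∞} {P : ℝ} (hP : 0 < P)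
    (hh : Function.Periodic h P) {R : ℝ} (hR : 0 ≤ R) :
    ∫⁻ t in Ioc 0 R, h t ≤ ENNReal.ofReal (⌊R / P⌋ + 1) * ∫⁻ t in Ioc 0 P, h t := by
  have h0 : 0 ≤ R / P := by positivity
  rw [← natCast_floor_eq_intCast_floor h0, ← Nat.cast_add_one, ENNReal.ofReal_natCast,
    ← setLIntegral_Ioc_nat_mul_of_periodic hP hh]
  refine lintegral_mono_set (Ioc_subset_Ioc_right ?_)
  rw [← div_le_iff₀ hP]
  push_cast
  exact (Nat.lt_floor_add_one _).le

theorem setLIntegral_Ioc_mul_comp_div {P c : ℝ} (hc : 0 < c) (h : ℝ → ℝ≥0∞) :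
    ∫⁻ t in Ioc 0 (P * c), h (t / c) = ENNReal.ofReal c * ∫⁻ t in Ioc 0 P, h t := by
  have him : (fun t : ℝ => t * c) '' Ioc 0 P = Ioc 0 (P * c) := by
    rw [image_mul_right_Ioc 0 P hc, zero_mul]
  rw [← him, lintegral_image_eq_lintegral_abs_deriv_mul (f' := fun _ => c) measurableSet_Ioc
    (fun x _ => (hasDerivAt_mul_const c).hasDerivWithinAt)
    (mul_left_injective₀ hc.ne').injOn, abs_of_pos hc]
  have e : ∀ x : ℝ, x * c / c = x := fun x => mul_div_cancel_right₀ x hc.ne'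
  simp only [e]
  exact lintegral_const_mul' _ _ ENNReal.ofReal_ne_top

theorem setLIntegral_Ioc_comp_neg_of_periodic {h : ℝ → ℝ≥0∞} {P : ℝ} (hP : 0 < P)
    (hh : Function.Periodic h P) :
    ∫⁻ t in Ioc 0 P, h (-t) = ∫⁻ t in Ioc 0 P, h t := by
  have h1 := setLIntegral_Ioc_add_eq_of_periodic hP hh (-P) 0
  rw [zero_add, neg_add_cancel] at h1
  rw [← h1, ← restrict_Ico_eq_restrict_Ioc (a := -P),
    ← (Measure.measurePreserving_neg (volume : Measure ℝ)).setLIntegral_comp_preimage_emb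
      (MeasurableEquiv.neg ℝ).measurableEmbedding]
  simp

theorem setLIntegral_Ioi_one_eq_comp_div {s ε : ℝ} (hs : 0 < s) (Φ : ℝ → ℝ≥0∞) :
    ∫⁻ a in Ioi 1, Φ (s / a) * ENNReal.ofReal (a ^ (ε - 1))
      = ∫⁻ b in Ioo 0 s, Φ b * ENNReal.ofReal (s ^ ε * b ^ (-ε - 1)) := by
  have him : (fun b : ℝ => s / b) '' Ioo 0 s = Ioi 1 := by
    ext x
    constructor
    · rintro ⟨b, hb, rfl⟩
      exact (one_lt_div hb.1).2 hb.2
    · intro hx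
      have hx0 : 0 < x := one_pos.trans hx
      exact ⟨s / x, ⟨by positivity, div_lt_self hs hx⟩, by field_simp⟩
  rw [← him, lintegral_image_eq_lintegral_abs_deriv_mul (f' := fun b => -(s / b ^ 2))
    measurableSet_Ioo]
  · refine setLIntegral_congr_fun measurableSet_Ioo fun b hb => ?_
    have hb0 : 0 < b := hb.1
    have e : s / (s / b) = b := by field_simp
    simp only [e, abs_neg]
    rw [abs_of_pos (by positivity), mul_left_comm, ← ENNReal.ofReal_mul (by positivity),
      Real.div_rpow hs.le hb0.le, Real.rpow_sub hs, Real.rpow_sub hb0, Real.rpow_sub hb0,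
      Real.rpow_neg hb0.le, Real.rpow_one, Real.rpow_one]
    congr 2
    field_simp
  · intro b hb
    simpa only [div_eq_mul_inv, mul_neg] using
      ((hasDerivAt_inv hb.1.ne').const_mul s).hasDerivWithinAt (s := Ioo 0 s)
  · intro x hx y hy h
    have h1 := hx.1.ne'
    have h2 := hy.1.ne'
    simp only at h
    field_simp at h
    exact h.symm

theorem lintegral_lintegral_lintegral_reverse {μ ν ρ : Measure ℝ} [SFinite μ] [SFinite ν]
    [SFinite ρ] {G : ℝ → ℝ → ℝ → ℝ≥0∞}
    (hG : Measurable fun q : ℝ × ℝ × ℝ => G q.1 q.2.1 q.2.2) :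
    ∫⁻ x, ∫⁻ y, ∫⁻ z, G x y z ∂ρ ∂ν ∂μ = ∫⁻ z, ∫⁻ y, ∫⁻ x, G x y z ∂μ ∂ν ∂ρ := by
  have e1 : ∀ x, ∫⁻ y, ∫⁻ z, G x y z ∂ρ ∂ν = ∫⁻ z, ∫⁻ y, G x y z ∂ν ∂ρ := fun x =>
    lintegral_lintegral_swap (hG.comp measurable_prodMk_left).aemeasurable
  have e2 : ∀ z, ∫⁻ y, ∫⁻ x, G x y z ∂μ ∂ν = ∫⁻ x, ∫⁻ y, G x y z ∂ν ∂μ := fun z =>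
    lintegral_lintegral_swap
      (hG.comp (f := fun r : ℝ × ℝ => (r.2, r.1, z)) (by fun_prop)).aemeasurable
  simp only [e1, e2]
  refine lintegral_lintegral_swap (Measurable.aemeasurable ?_)
  exact Measurable.lintegral_prod_right' (f := fun w : (ℝ × ℝ) × ℝ => G w.1.1 w.2 w.1.2)
    (hG.comp (f := fun w : (ℝ × ℝ) × ℝ => (w.1.1, w.2, w.1.2)) (by fun_prop))

theorem lintegral_lintegral_mul_reverse {μ ν ρ : Measure ℝ} [SFinite μ] [SFinite ν]
    [SFinite ρ] {G : ℝ → ℝ → ℝ → ℝ≥0∞}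
    (hG : Measurable fun q : ℝ × ℝ × ℝ => G q.1 q.2.1 q.2.2) {w : ℝ → ℝ} (hw : Measurable w) :
    ∫⁻ x, ∫⁻ y, (∫⁻ z, G x y z ∂ρ) * ENNReal.ofReal (w y) ∂ν ∂μ
      = ∫⁻ z, ∫⁻ y, (∫⁻ x, G x y z ∂μ) * ENNReal.ofReal (w y) ∂ν ∂ρ := by
  simp only [← lintegral_mul_const' _ _ ENNReal.ofReal_ne_top]
  refine lintegral_lintegral_lintegral_reverse (G := fun x y z => G x y z * ENNReal.ofReal (w y)) ?_
  exact hG.mul (ENNReal.measurable_ofReal.comp (hw.comp (f := fun q : ℝ × ℝ × ℝ => q.2.1)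
    (by fun_prop)))

/-- The integrand `|f(k_θ n_T d_a)|²` of `normXSq`. -/
def kanSq (f : SL2 → ℂ) (θ T a : ℝ) : ℝ≥0∞ :=
  (‖f (kRot θ * nMat T * dMat a)‖₊ : ℝ≥0∞) ^ 2

theorem measurable_kanSq {f : SL2 → ℂ} (hf : Measurable f) :
    Measurable fun q : ℝ × ℝ × ℝ => kanSq f q.1 q.2.1 q.2.2 :=
  (hf.comp measurable_kRot_mul_nMat_mul_dMat).nnnorm.coe_nnreal_ennreal.pow_const 2

theorem measurable_lintegral_kanSq {f : SL2 → ℂ} (hf : Measurable f) (C : Set ℝ) (η : ℝ) :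
    Measurable fun w : ℝ × ℝ =>
      (∫⁻ T in C, kanSq f w.1 T w.2) * ENNReal.ofReal (w.2 ^ η) := by
  refine Measurable.mul ?_ (by fun_prop)
  exact Measurable.lintegral_prod_right' (f := fun w : (ℝ × ℝ) × ℝ => kanSq f w.1.1 w.2 w.1.2)
    ((measurable_kanSq hf).comp (f := fun w : (ℝ × ℝ) × ℝ => (w.1.1, w.2, w.1.2)) (by fun_prop))

theorem kanSq_eq (f : SL2 → ℂ) (θ T : ℝ) {a : ℝ} (ha : a ≠ 0) :
    kanSq f θ T a = (‖f (kRot θ * dMat a * nMat (T / a ^ 2))‖₊ : ℝ≥0∞) ^ 2 := by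
  rw [kanSq, mul_assoc, nMat_mul_dMat ha, ← mul_assoc]

theorem setLIntegral_kanSq_eq {f : SL2 → ℂ} (hw : ∀ x : SL2, ‖f (x * wMat)‖ = ‖f x‖)
    (T : ℝ) {a : ℝ} (ha : 0 < a) :
    ∫⁻ θ in Ioc (0 : ℝ) (2 * π), kanSq f θ T a
      = ∫⁻ θ in Ioc (0 : ℝ) (2 * π), kanSq f θ (-T) (√(T ^ 2 + 1) / a) := by
  obtain ⟨φ, hφ⟩ := exists_nMat_mul_dMat_mul_wMat T
  have hrot : ∀ θ, kanSq f θ T a = kanSq f (θ + φ) (-T) (√(T ^ 2 + 1) / a) := fun θ => by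
    have h1 : ‖f (kRot θ * nMat T * dMat a)‖₊
        = ‖f (kRot (θ + φ) * nMat (-T) * dMat (√(T ^ 2 + 1) / a))‖₊ := by
      refine NNReal.eq ?_
      rw [coe_nnnorm, coe_nnnorm, ← hw, ← kRot_mul_kRot]
      simp only [mul_assoc] at hφ ⊢
      rw [hφ a ha]
    rw [kanSq, h1, kanSq]
  have hper : Function.Periodic (fun θ => kanSq f θ (-T) (√(T ^ 2 + 1) / a)) (2 * π) := fun θ => by
    simp only [kanSq, kRot_periodic θ]
  have h1 := setLIntegral_Ioc_add_eq_of_periodic Real.two_pi_pos hper φ 0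
  rw [zero_add] at h1
  have h2 := (measurePreserving_add_right (volume : Measure ℝ) φ).setLIntegral_comp_preimage_emb
    (measurableEmbedding_addRight φ) (fun θ => kanSq f θ (-T) (√(T ^ 2 + 1) / a))
    (Ioc φ (φ + 2 * π))
  rw [preimage_add_const_Ioc, sub_self, add_sub_cancel_left] at h2
  rw [← h1, ← h2]
  simp only [hrot]

theorem setLIntegral_comp_div_sq_bounds {h : ℝ → ℝ≥0∞} {P : ℝ} (hP : 0 < P)
    (hh : Function.Periodic h P) {R : ℝ} (hR : 0 ≤ R) {a : ℝ} (ha : 0 < a) :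
    ENNReal.ofReal (a ^ 2 * ⌊R / (P * a ^ 2)⌋) * (∫⁻ t in Ioc 0 P, h t)
        ≤ ∫⁻ T in Ioc 0 R, h (T / a ^ 2) ∧
      ∫⁻ T in Ioc 0 R, h (T / a ^ 2)
        ≤ ENNReal.ofReal (a ^ 2 * (⌊R / (P * a ^ 2)⌋ + 1)) * ∫⁻ t in Ioc 0 P, h t := by
  have ha2 : 0 < a ^ 2 := by positivity
  have hper : Function.Periodic (fun T => h (T / a ^ 2)) (P * a ^ 2) := fun T => by
    simp only [add_div, mul_div_cancel_right₀ P ha2.ne', hh (T / a ^ 2)]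
  have h1 := floor_mul_le_setLIntegral_of_periodic (mul_pos hP ha2) hper hR
  have h2 := setLIntegral_le_floor_mul_of_periodic (mul_pos hP ha2) hper hR
  rw [setLIntegral_Ioc_mul_comp_div ha2, ← mul_assoc, mul_comm (ENNReal.ofReal _)] at h1 h2
  rw [ENNReal.ofReal_mul ha2.le, ENNReal.ofReal_mul ha2.le]
  exact ⟨h1, h2⟩

theorem kanSlice_periodic {f : SL2 → ℂ} {P : ℝ} (hper : ∀ x : SL2, f (x * nMat P) = f x)
    (x : SL2) : Function.Periodic (fun t => (‖f (x * nMat t)‖₊ : ℝ≥0∞) ^ 2) P := fun t => by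
  simp only [← nMat_mul_nMat, ← mul_assoc, hper]

theorem setLIntegral_kanSq_bounds {f : SL2 → ℂ} {P : ℝ} (hP : 0 < P)
    (hper : ∀ x : SL2, f (x * nMat P) = f x) {R : ℝ} (hR : 0 ≤ R) (θ : ℝ) {a : ℝ} (ha : 0 < a) :
    ENNReal.ofReal (a ^ 2 * ⌊R / (P * a ^ 2)⌋) *
          (∫⁻ t in Ioc 0 P, (‖f (kRot θ * dMat a * nMat t)‖₊ : ℝ≥0∞) ^ 2)
        ≤ ∫⁻ T in Ioc 0 R, kanSq f θ T a ∧
      ∫⁻ T in Ioc 0 R, kanSq f θ T a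
        ≤ ENNReal.ofReal (a ^ 2 * (⌊R / (P * a ^ 2)⌋ + 1)) *
          ∫⁻ t in Ioc 0 P, (‖f (kRot θ * dMat a * nMat t)‖₊ : ℝ≥0∞) ^ 2 := by
  simp only [kanSq_eq f _ _ ha.ne']
  exact setLIntegral_comp_div_sq_bounds hP (kanSlice_periodic hper _) hR ha

theorem setLIntegral_kanSq_neg_bounds {f : SL2 → ℂ} {P : ℝ} (hP : 0 < P)
    (hper : ∀ x : SL2, f (x * nMat P) = f x) {R : ℝ} (hR : 0 ≤ R) (θ : ℝ) {a : ℝ} (ha : 0 < a) :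
    ENNReal.ofReal (a ^ 2 * ⌊R / (P * a ^ 2)⌋) *
          (∫⁻ t in Ioc 0 P, (‖f (kRot θ * dMat a * nMat t)‖₊ : ℝ≥0∞) ^ 2)
        ≤ ∫⁻ T in Ioc 0 R, kanSq f θ (-T) a ∧
      ∫⁻ T in Ioc 0 R, kanSq f θ (-T) a
        ≤ ENNReal.ofReal (a ^ 2 * (⌊R / (P * a ^ 2)⌋ + 1)) *
          ∫⁻ t in Ioc 0 P, (‖f (kRot θ * dMat a * nMat t)‖₊ : ℝ≥0∞) ^ 2 := by
  have hh := kanSlice_periodic hper (kRot θ * dMat a)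
  have hneg : Function.Periodic
      (fun t => (‖f (kRot θ * dMat a * nMat (-t))‖₊ : ℝ≥0∞) ^ 2) P := fun t => by
    simpa [add_comm, sub_eq_add_neg] using hh.sub_eq (-t)
  simp only [kanSq_eq f _ _ ha.ne', neg_div]
  rw [← setLIntegral_Ioc_comp_neg_of_periodic hP hh]
  exact setLIntegral_comp_div_sq_bounds hP hneg hR ha

theorem ofReal_sq_mul_mul_rpow_sub_one {a c : ℝ} (ha : 0 < a) (η : ℝ) (I : ℝ≥0∞) :
    ENNReal.ofReal (a ^ 2 * c) * I * ENNReal.ofReal (a ^ (η - 1))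
      = ENNReal.ofReal (a ^ (2 + η) * c) * I * ENNReal.ofReal a⁻¹ := by
  rw [mul_right_comm, mul_right_comm _ I, ← ENNReal.ofReal_mul' (by positivity),
    ← ENNReal.ofReal_mul' (by positivity), Real.rpow_sub ha, Real.rpow_add ha, Real.rpow_one,
    Real.rpow_two]
  congr 2
  field_simp

theorem normXSq_eq_add {f : SL2 → ℂ} (hf : Measurable f) (T₁ ε : ℝ) :
    normXSq f T₁ ε =
      (∫⁻ θ in Ioc (0 : ℝ) (2 * π), ∫⁻ a in Ioc (0 : ℝ) 1,
        (∫⁻ T in Ioc 0 T₁, kanSq f θ T a) * ENNReal.ofReal (a ^ (ε - 1))) +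
      ∫⁻ θ in Ioc (0 : ℝ) (2 * π), ∫⁻ a in Ioi (1 : ℝ),
        (∫⁻ T in Ioc 0 T₁, kanSq f θ T a) * ENNReal.ofReal (a ^ (ε - 1)) := by
  have h1 : ∀ θ, ∫⁻ a in Ioi (0 : ℝ), (∫⁻ T in Ioc (0 : ℝ) T₁,
      (‖f (kRot θ * nMat T * dMat a)‖₊ : ℝ≥0∞) ^ 2 * ENNReal.ofReal (a ^ ε)) * ENNReal.ofReal a⁻¹
      = ∫⁻ a in Ioi (0 : ℝ), (∫⁻ T in Ioc 0 T₁, kanSq f θ T a) * ENNReal.ofReal (a ^ (ε - 1)) :=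
    fun θ => setLIntegral_congr_fun measurableSet_Ioi fun a ha => by
      have ha0 : 0 < a := ha
      simp only [lintegral_mul_const' _ _ ENNReal.ofReal_ne_top, kanSq]
      rw [mul_assoc, ← ENNReal.ofReal_mul (by positivity), Real.rpow_sub_one ha0.ne', div_eq_mul_inv]
  rw [normXSq]
  simp only [h1]
  rw [← Ioc_union_Ioi_eq_Ioi zero_le_one]
  simp only [lintegral_union measurableSet_Ioi (Ioc_disjoint_Ioi le_rfl)]
  refine lintegral_add_left ?_ _
  exact (measurable_lintegral_kanSq hf _ _).lintegral_prod_right'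

theorem lintegral_kanSq_Ioi_one {f : SL2 → ℂ} (hf : Measurable f)
    (hw : ∀ x : SL2, ‖f (x * wMat)‖ = ‖f x‖) (T₁ ε : ℝ) :
    ∫⁻ θ in Ioc (0 : ℝ) (2 * π), ∫⁻ a in Ioi (1 : ℝ),
        (∫⁻ T in Ioc 0 T₁, kanSq f θ T a) * ENNReal.ofReal (a ^ (ε - 1))
      = ∫⁻ T in Ioc 0 T₁, ∫⁻ b in Ioo 0 √(T ^ 2 + 1),
        (∫⁻ θ in Ioc (0 : ℝ) (2 * π), kanSq f θ (-T) b) *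
          ENNReal.ofReal (√(T ^ 2 + 1) ^ ε * b ^ (-ε - 1)) := by
  rw [lintegral_lintegral_mul_reverse (G := fun θ a T => kanSq f θ T a)
    ((measurable_kanSq hf).comp (f := fun q : ℝ × ℝ × ℝ => (q.1, q.2.2, q.2.1)) (by fun_prop))
    (w := fun a => a ^ (ε - 1)) (by fun_prop)]
  refine lintegral_congr fun T => ?_
  rw [← setLIntegral_Ioi_one_eq_comp_div (by positivity)
    fun b => ∫⁻ θ in Ioc (0 : ℝ) (2 * π), kanSq f θ (-T) b]
  refine setLIntegral_congr_fun measurableSet_Ioi fun a ha => ?_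
  simp only [setLIntegral_kanSq_eq hw T (one_pos.trans ha)]

theorem lintegral_kanSq_neg_Ioc {f : SL2 → ℂ} (hf : Measurable f) (T₁ ε B : ℝ) :
    ∫⁻ θ in Ioc (0 : ℝ) (2 * π), ∫⁻ b in Ioc (0 : ℝ) B,
        (∫⁻ T in Ioc 0 T₁, kanSq f θ (-T) b) * ENNReal.ofReal (b ^ (-ε - 1))
      = ∫⁻ T in Ioc 0 T₁, ∫⁻ b in Ioc (0 : ℝ) B,
        (∫⁻ θ in Ioc (0 : ℝ) (2 * π), kanSq f θ (-T) b) * ENNReal.ofReal (b ^ (-ε - 1)) :=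
  lintegral_lintegral_mul_reverse (G := fun θ a T => kanSq f θ (-T) a)
    ((measurable_kanSq hf).comp (f := fun q : ℝ × ℝ × ℝ => (q.1, -q.2.2, q.2.1)) (by fun_prop))
    (w := fun a => a ^ (-ε - 1)) (by fun_prop)

theorem lintegral_kanSq_neg_Ioc_one_le {f : SL2 → ℂ} (hf : Measurable f)
    (hw : ∀ x : SL2, ‖f (x * wMat)‖ = ‖f x‖) (T₁ : ℝ) {ε : ℝ} (hε : 0 ≤ ε) :
    ∫⁻ θ in Ioc (0 : ℝ) (2 * π), ∫⁻ b in Ioc (0 : ℝ) 1,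
        (∫⁻ T in Ioc 0 T₁, kanSq f θ (-T) b) * ENNReal.ofReal (b ^ (-ε - 1))
      ≤ ∫⁻ θ in Ioc (0 : ℝ) (2 * π), ∫⁻ a in Ioi (1 : ℝ),
        (∫⁻ T in Ioc 0 T₁, kanSq f θ T a) * ENNReal.ofReal (a ^ (ε - 1)) := by
  rw [lintegral_kanSq_neg_Ioc hf, lintegral_kanSq_Ioi_one hf hw]
  refine setLIntegral_mono' measurableSet_Ioc fun T hT => ?_
  have hs : 1 < √(T ^ 2 + 1) := by
    rw [Real.lt_sqrt one_pos.le]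
    have := pow_pos hT.1 2
    linarith
  refine (lintegral_mono_set (Ioc_subset_Ioo_right hs)).trans ?_
  refine setLIntegral_mono' measurableSet_Ioo fun b hb => ?_
  gcongr
  exact le_mul_of_one_le_left (Real.rpow_nonneg hb.1.le _) (Real.one_le_rpow hs.le hε)

theorem lintegral_kanSq_Ioi_one_le {f : SL2 → ℂ} (hf : Measurable f)
    (hw : ∀ x : SL2, ‖f (x * wMat)‖ = ‖f x‖) (T₁ : ℝ) {ε : ℝ} (hε : 0 ≤ ε) :
    ∫⁻ θ in Ioc (0 : ℝ) (2 * π), ∫⁻ a in Ioi (1 : ℝ),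
        (∫⁻ T in Ioc 0 T₁, kanSq f θ T a) * ENNReal.ofReal (a ^ (ε - 1))
      ≤ ENNReal.ofReal ((T₁ ^ 2 + 1) ^ (ε / 2)) *
        ∫⁻ θ in Ioc (0 : ℝ) (2 * π), ∫⁻ b in Ioc (0 : ℝ) √(T₁ ^ 2 + 1),
          (∫⁻ T in Ioc 0 T₁, kanSq f θ (-T) b) * ENNReal.ofReal (b ^ (-ε - 1)) := by
  rw [lintegral_kanSq_neg_Ioc hf, lintegral_kanSq_Ioi_one hf hw,
    ← lintegral_const_mul' _ _ ENNReal.ofReal_ne_top]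
  refine setLIntegral_mono' measurableSet_Ioc fun T hT => ?_
  have hT2 : T ^ 2 + 1 ≤ T₁ ^ 2 + 1 := by
    have := pow_le_pow_left₀ hT.1.le hT.2 2
    linarith
  have hs : √(T ^ 2 + 1) ≤ √(T₁ ^ 2 + 1) := Real.sqrt_le_sqrt hT2
  have hpow : √(T ^ 2 + 1) ^ ε ≤ (T₁ ^ 2 + 1) ^ (ε / 2) := by
    rw [Real.sqrt_eq_rpow, ← Real.rpow_mul (by positivity), one_div_mul_eq_div]
    exact Real.rpow_le_rpow (by positivity) hT2 (by positivity)
  rw [← lintegral_const_mul' _ _ ENNReal.ofReal_ne_top]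
  refine (lintegral_mono_set (Ioo_subset_Ioc_self.trans (Ioc_subset_Ioc_right hs))).trans ?_
  refine setLIntegral_mono' measurableSet_Ioc fun b hb => ?_
  rw [mul_left_comm, ← ENNReal.ofReal_mul (by positivity)]
  gcongr
  exact Real.rpow_nonneg hb.1.le _

/-- upper and lower bounds on `‖f‖²_{T₁,ε}` (`ε > 0`) by Siegel-type
integrals in KAN coordinates. -/
theorem stmt3 (p : ℕ) (hp : 0 < p) (T₁ : ℝ) (hT₁ : 0 < T₁) (ε : ℝ) (hε : 0 < ε)
    (f : SL2 → ℂ) (hf : Measurable f) (hloc : LocSqInt f)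
    (hper : ∀ x : SL2, f (x * nMat (p : ℝ)) = f x)
    (hw : ∀ x : SL2, ‖f (x * wMat)‖ = ‖f x‖) :
    (∫⁻ θ in Ioc (0:ℝ) (2 * π), ∫⁻ a in Ioc (0:ℝ) 1,
        ENNReal.ofReal ((a ^ ((2:ℝ) + ε) + a ^ ((2:ℝ) - ε)) *
            ((⌊T₁ / ((p : ℝ) * a ^ 2)⌋ : ℤ) : ℝ)) *
          (∫⁻ t in Ioc (0:ℝ) (p : ℝ), (‖f (kRot θ * dMat a * nMat t)‖₊ : ℝ≥0∞) ^ 2) *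
          ENNReal.ofReal a⁻¹)
      ≤ normXSq f T₁ ε ∧
    normXSq f T₁ ε ≤
      (∫⁻ θ in Ioc (0:ℝ) (2 * π), ∫⁻ a in Ioc (0:ℝ) 1,
          ENNReal.ofReal (a ^ ((2:ℝ) + ε) * (((⌊T₁ / ((p : ℝ) * a ^ 2)⌋ : ℤ) : ℝ) + 1)) *
            (∫⁻ t in Ioc (0:ℝ) (p : ℝ), (‖f (kRot θ * dMat a * nMat t)‖₊ : ℝ≥0∞) ^ 2) *
            ENNReal.ofReal a⁻¹)
        + ENNReal.ofReal ((T₁ ^ 2 + 1) ^ (ε / 2)) *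
          (∫⁻ θ in Ioc (0:ℝ) (2 * π), ∫⁻ a in Ioc (0:ℝ) (Real.sqrt (T₁ ^ 2 + 1)),
            ENNReal.ofReal (a ^ ((2:ℝ) - ε) * (((⌊T₁ / ((p : ℝ) * a ^ 2)⌋ : ℤ) : ℝ) + 1)) *
              (∫⁻ t in Ioc (0:ℝ) (p : ℝ), (‖f (kRot θ * dMat a * nMat t)‖₊ : ℝ≥0∞) ^ 2) *
              ENNReal.ofReal a⁻¹) := by
  have hp' : (0 : ℝ) < p := Nat.cast_pos.2 hp
  rw [normXSq_eq_add hf]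
  constructor
  · refine le_trans ?_ (add_le_add_right (lintegral_kanSq_neg_Ioc_one_le hf hw T₁ hε.le) _)
    rw [← lintegral_add_left (measurable_lintegral_kanSq hf _ _).lintegral_prod_right']
    refine lintegral_mono fun θ => ?_
    refine le_trans ?_ (lintegral_add_left
      ((measurable_lintegral_kanSq hf _ _).comp measurable_prodMk_left) _).le
    refine setLIntegral_mono' measurableSet_Ioc fun a ha => ?_
    have h0 : 0 ≤ T₁ / (p * a ^ 2) := by positivity
    have h1 : (0 : ℝ) ≤ ⌊T₁ / (p * a ^ 2)⌋ := by exact_mod_cast Int.floor_nonneg.2 h0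
    have ha0 := ha.1
    rw [add_mul, ENNReal.ofReal_add (by positivity) (by positivity), add_mul, add_mul,
      sub_eq_add_neg 2 ε, ← ofReal_sq_mul_mul_rpow_sub_one ha.1, ← ofReal_sq_mul_mul_rpow_sub_one ha.1]
    gcongr
    · simp only [Function.comp_apply]
      gcongr
      exact (setLIntegral_kanSq_bounds hp' hper hT₁.le θ ha.1).1
    · exact (setLIntegral_kanSq_neg_bounds hp' hper hT₁.le θ ha.1).1
  · refine add_le_add ?_ ((lintegral_kanSq_Ioi_one_le hf hw T₁ hε.le).trans
      (mul_le_mul_right ?_ _))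
    · refine lintegral_mono fun θ => setLIntegral_mono' measurableSet_Ioc fun a ha => ?_
      rw [← ofReal_sq_mul_mul_rpow_sub_one ha.1]
      gcongr
      exact (setLIntegral_kanSq_bounds hp' hper hT₁.le θ ha.1).2
    · refine lintegral_mono fun θ => setLIntegral_mono' measurableSet_Ioc fun a ha => ?_
      rw [sub_eq_add_neg 2 ε, ← ofReal_sq_mul_mul_rpow_sub_one ha.1]
      gcongr
      exact (setLIntegral_kanSq_neg_bounds hp' hper hT₁.le θ ha.1).2
end
end

section
/- Fix a positive integer p, u = u₀ + iu₁ ∈ ℂ with u₀ = Re(u) < 1, and complex coefficients (b_m)_{m ∈ ℤ∖{0}} of at most polynomial growth. Suppose there exists a continuous rapidly decreasing φ : ℝ → ℂ with φ(x) ≠ 0 for every x ≠ 0 such that f_φ(a,t) = a^{−1−u} Σ_{m ≠ 0} φ(−(m/p) a^{−2}) b_m e^{−2πi t m/p} is bounded on (0,∞) × ℝ. Then for every ε > 0 there is a constant C > 0 such that for every a₁ > 0 and every continuous rapidly decreasing ψ : ℝ → ℂ, with f_ψ defined by the same series with ψ in place of φ: ∫₀^{a₁} ∫₀^{p} |f_ψ(a,t)|²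 dt a^{ε} da/a ≤ C a₁^{ε} ∫_{|a| ≥ 1/(a₁² p)} |a|^{u₀} |ψ(a)|² da. -/
open MeasureTheory Real Set
open scoped ENNReal NNReal

noncomputable section

/-- `ψ : ℝ → ℂ` is rapidly decreasing: `sup_x (1+|x|)^k ‖ψ x‖ < ∞` for every `k`. -/
def RapidDecay (ψ : ℝ → ℂ) : Prop :=
  ∀ k : ℕ, ∃ C : ℝ, ∀ x : ℝ, (1 + |x|) ^ k * ‖ψ x‖ ≤ C

/-- Coefficients `(b_m)` of at most polynomial growth. -/
def PolyGrowth (b : ℤ → ℂ) : Prop :=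
  ∃ C N : ℝ, ∀ m : ℤ, ‖b m‖ ≤ C * (1 + |(m : ℝ)|) ^ N

/-- The Fourier–Whittaker series
`f_ψ(a,t) = a^{−1−u} Σ_{m ≠ 0} ψ(−(m/p) a^{−2}) b_m e^{−2πi t m/p}`
(the `m = 0` term vanishes since `b 0 = 0` in all statements below). -/
def fW (p : ℕ) (u : ℂ) (b : ℤ → ℂ) (ψ : ℝ → ℂ) (a t : ℝ) : ℂ :=
  (a : ℂ) ^ (-1 - u) *
    ∑' m : ℤ, ψ (-((m : ℝ) / (p : ℝ)) * a ^ (-2 : ℤ)) * b m *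
      Complex.exp (-2 * (π : ℂ) * Complex.I * (t : ℂ) * (m : ℂ) / (p : ℂ))

/-- The weighted `L²`-norm `∫_s ∫₀^p |f_ψ(a,t)|² dt a^ε da/a` over a set `s` of `a`'s. -/
def lhsInt (p : ℕ) (u : ℂ) (b : ℤ → ℂ) (ψ : ℝ → ℂ) (ε : ℝ) (s : Set ℝ) : ℝ≥0∞ :=
  ∫⁻ a in s,
    (∫⁻ t in Ioc (0:ℝ) (p : ℝ), (‖fW p u b ψ a t‖₊ : ℝ≥0∞) ^ 2) *
      ENNReal.ofReal (a ^ ε) * ENNReal.ofReal a⁻¹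

theorem lintegral_sq_tsum_exp {T : ℝ} (hT : 0 < T) {c : ℤ → ℂ} (hc : Summable fun n => ‖c n‖) :
    ∫⁻ t in Ioc (0 : ℝ) T, ‖∑' n : ℤ, c n *
        Complex.exp (-2 * (π : ℂ) * Complex.I * (t : ℂ) * (n : ℂ) / (T : ℂ))‖ₑ ^ 2 =
      ENNReal.ofReal T * ∑' n : ℤ, ‖c n‖ₑ ^ 2 := by
  have : Fact (0 < T) := ⟨hT⟩
  set d : ℤ → ℂ := fun n => c (-n) with hd
  have hds : Summable fun n => ‖d n‖ := (Equiv.neg ℤ).summable_iff.2 hc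
  have hdmem : Memℓp d 2 :=
    (memℓp_gen (p := 1) (by simpa using hds)).of_exponent_ge (by norm_num)
  let F : lp (fun _ : ℤ => ℂ) 2 := ⟨d, hdmem⟩
  have hsum : Summable fun n => d n • fourier (T := T) n :=
    Summable.of_norm (by simpa only [norm_smul, fourier_norm, mul_one] using hds)
  set g : C(AddCircle T, ℂ) := ∑' n, d n • fourier n with hg
  have hLp : ContinuousMap.toLp 2 AddCircle.haarAddCircle ℂ g = fourierBasis.repr.symm F := by
    have h1 := (fourierBasis (T := T)).hasSum_repr_symm F
    have h2 := (ContinuousMap.toLp 2 AddCircle.haarAddCircle ℂ).hasSum hsum.hasSum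
    refine h2.unique ?_
    convert h1 using 2 with n
    simp [F, coe_fourierBasis, fourierLp]
  have hgt : ∀ t : ℝ, g t = ∑' n : ℤ, c n *
      Complex.exp (-2 * (π : ℂ) * Complex.I * (t : ℂ) * (n : ℂ) / (T : ℂ)) := by
    intro t
    rw [hg, ← ContinuousMap.tsum_apply hsum, ← (Equiv.neg ℤ).tsum_eq]
    refine tsum_congr fun n => ?_
    simp only [Equiv.neg_apply, hd, neg_neg, ContinuousMap.smul_apply, fourier_coe_apply,
      smul_eq_mul]
    congr 2
    push_cast
    ring
  have hnorm : ∫⁻ x, ‖g x‖ₑ ^ 2 ∂(AddCircle.haarAddCircle (T := T)) = ∑' n : ℤ, ‖c n‖ₑ ^ 2 := by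
    have h1 : ∫⁻ x, ‖g x‖ₑ ^ 2 ∂(AddCircle.haarAddCircle (T := T)) =
        ‖ContinuousMap.toLp 2 AddCircle.haarAddCircle ℂ g‖ₑ ^ 2 := by
      rw [Lp.enorm_def, eLpNorm_congr_ae (ContinuousMap.coeFn_toLp _ g)]
      have := eLpNorm_nnreal_pow_eq_lintegral (f := g) (p := 2)
        (μ := AddCircle.haarAddCircle (T := T)) two_ne_zero
      simpa using this.symm
    have h2 : ‖F‖ ^ 2 = ∑' n, ‖d n‖ ^ 2 := by
      have := lp.norm_rpow_eq_tsum (p := 2) (by norm_num) F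
      simpa [F] using this
    have hs2 : Summable fun n => ‖d n‖ ^ 2 := by
      have := hdmem.summable (by norm_num)
      simpa using this
    rw [h1, hLp, ← ofReal_norm, LinearIsometryEquiv.norm_map,
      ← ENNReal.ofReal_pow (norm_nonneg _), h2,
      ENNReal.ofReal_tsum_of_nonneg (fun _ => by positivity) hs2, ← (Equiv.neg ℤ).tsum_eq]
    refine tsum_congr fun n => ?_
    simp [hd, ENNReal.ofReal_pow]
  have h := AddCircle.lintegral_preimage T 0 fun x => ‖g x‖ₑ ^ 2
  rw [AddCircle.volume_eq_smul_haarAddCircle, lintegral_smul_measure, hnorm, zero_add,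
    smul_eq_mul] at h
  simpa only [hgt] using h

theorem RapidDecay.summable_mul {ψ : ℝ → ℂ} (hψ : RapidDecay ψ) {b : ℤ → ℂ} (hb : PolyGrowth b)
    {κ : ℝ} (hκ : κ ≠ 0) :
    Summable fun m : ℤ => ‖ψ (m * κ) * b m‖ := by
  obtain ⟨C, N, hC⟩ := hb
  obtain ⟨k, hk⟩ := exists_nat_ge (N + 2)
  obtain ⟨D, hD⟩ := hψ k
  have hC0 : 0 ≤ C := by
    have := (norm_nonneg _).trans (hC 0)
    simpa using this
  set q := min 1 |κ| with hq
  have hq0 : 0 < q := lt_min one_pos (abs_pos.2 hκ)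
  have hD0 : 0 ≤ D := le_trans (by positivity) (hD 0)
  refine Summable.of_norm_bounded_eventually
    (g := fun m : ℤ => C * D / q ^ k * |(m : ℝ)| ^ (-2 : ℝ))
    ((Real.summable_abs_int_rpow one_lt_two).mul_left _) ?_
  have hfin : ({0} : Set ℤ).Finite := Set.finite_singleton 0
  filter_upwards [hfin.compl_mem_cofinite] with m hm
  have hm0 : (0 : ℝ) < |(m : ℝ)| := by simpa using hm
  rw [norm_norm, norm_mul]
  set x := 1 + |(m : ℝ)| with hx
  have hx1 : 1 ≤ x := by linarith
  have hqx : q * x ≤ 1 + |(m : ℝ) * κ| := by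
    rw [abs_mul, hx]
    nlinarith [min_le_left 1 |κ|, min_le_right 1 |κ|]
  have h1 : (q * x) ^ k * ‖ψ (m * κ)‖ ≤ D :=
    le_trans (by gcongr) (hD _)
  have h2 : ‖b m‖ * |(m : ℝ)| ^ (2 : ℝ) ≤ C * x ^ k := by
    calc ‖b m‖ * |(m : ℝ)| ^ (2 : ℝ) ≤ (C * x ^ N) * x ^ (2 : ℝ) := by
          gcongr
          · exact hC m
          · exact (lt_one_add _).le
      _ = C * x ^ (N + 2) := by rw [mul_assoc, ← Real.rpow_add (by linarith)]
      _ ≤ C * x ^ k := by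
          rw [← Real.rpow_natCast]
          gcongr
  rw [Real.rpow_neg hm0.le, ← div_eq_mul_inv, le_div_iff₀ (by positivity),
    le_div_iff₀ (by positivity)]
  calc ‖ψ (m * κ)‖ * ‖b m‖ * |(m : ℝ)| ^ (2 : ℝ) * q ^ k
      = (‖b m‖ * |(m : ℝ)| ^ (2 : ℝ)) * (q ^ k * ‖ψ (m * κ)‖) := by ring
    _ ≤ (C * x ^ k) * (q ^ k * ‖ψ (m * κ)‖) := by gcongr
    _ = C * ((q * x) ^ k * ‖ψ (m * κ)‖) := by rw [mul_pow]; ring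
    _ ≤ C * D := by gcongr

theorem lintegral_sq_fW {p : ℕ} (hp : 0 < p) (u : ℂ) {b : ℤ → ℂ} (hb : PolyGrowth b)
    {ψ : ℝ → ℂ} (hψ : RapidDecay ψ) {a : ℝ} (ha : 0 < a) :
    ∫⁻ t in Ioc (0 : ℝ) p, ‖fW p u b ψ a t‖ₑ ^ 2 =
      ENNReal.ofReal (p * a ^ (-2 - 2 * u.re)) *
        ∑' m : ℤ, ‖b m‖ₑ ^ 2 * ‖ψ (-((m : ℝ) / p) * a ^ (-2 : ℤ))‖ₑ ^ 2 := by
  have hp' : (0 : ℝ) < p := by exact_mod_cast hp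
  have hs : Summable fun m : ℤ => ‖ψ (-((m : ℝ) / p) * a ^ (-2 : ℤ)) * b m‖ := by
    have hκ : -(a ^ (-2 : ℤ) / p) ≠ 0 := by
      have : 0 < a ^ (-2 : ℤ) / p := by positivity
      linarith
    convert hψ.summable_mul hb hκ using 5 with m
    ring
  have hcp : ‖(a : ℂ) ^ (-1 - u)‖ₑ ^ 2 = ENNReal.ofReal (a ^ (-2 - 2 * u.re)) := by
    rw [← ofReal_norm, Complex.norm_cpow_eq_rpow_re_of_pos ha,
      ← ENNReal.ofReal_pow (by positivity), ← Real.rpow_natCast, ← Real.rpow_mul ha.le]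
    congr 2
    simp
    ring
  simp only [fW, enorm_mul, mul_pow]
  rw [lintegral_const_mul' _ _ (by finiteness), hcp]
  have := lintegral_sq_tsum_exp hp' hs
  simp only [Complex.ofReal_natCast, enorm_mul, mul_pow] at this
  rw [this, ← mul_assoc, mul_comm (ENNReal.ofReal _) (ENNReal.ofReal (p : ℝ)),
    ENNReal.ofReal_mul hp'.le]
  simp only [mul_comm (‖b _‖ₑ ^ 2)]

theorem exists_dyadic_bound {p : ℕ} (hp : 0 < p) {u : ℂ} {b : ℤ → ℂ} (hb : PolyGrowth b)
    {φ : ℝ → ℂ} (hφc : Continuous φ) (hφ : RapidDecay φ) (hφne : ∀ x : ℝ, x ≠ 0 → φ x ≠ 0)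
    {M : ℝ} (hbdd : ∀ a : ℝ, 0 < a → ∀ t : ℝ, ‖fW p u b φ a t‖ ≤ M) :
    ∃ K : ℝ, 0 ≤ K ∧ ∀ X : ℝ, 0 < X →
      ∑' m : ℤ, {m : ℤ | X < |(m : ℝ)| ∧ |(m : ℝ)| ≤ 2 * X}.indicator (fun m => ‖b m‖ₑ ^ 2) m ≤
        ENNReal.ofReal (K * X ^ (1 + u.re)) := by
  have hp' : (0 : ℝ) < p := by exact_mod_cast hp
  obtain ⟨c, hc0, hc⟩ : ∃ c : ℝ, 0 < c ∧ ∀ y : ℝ, 1 ≤ |y| → |y| ≤ 2 → c ≤ ‖φ y‖ := by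
    have hcomp : IsCompact {y : ℝ | 1 ≤ |y| ∧ |y| ≤ 2} := by
      refine (isCompact_Icc (a := (-2 : ℝ)) (b := 2)).of_isClosed_subset
        ((isClosed_le continuous_const continuous_abs).inter
          (isClosed_le continuous_abs continuous_const)) fun y hy => abs_le.1 hy.2
    obtain ⟨y, hy, hmin⟩ := hcomp.exists_isMinOn ⟨1, by norm_num, by norm_num⟩
      hφc.norm.continuousOn
    refine ⟨‖φ y‖, norm_pos_iff.2 (hφne y (abs_pos.1 (by linarith [hy.1]))), fun z h1 h2 => ?_⟩
    exact hmin ⟨h1, h2⟩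
  refine ⟨M ^ 2 / c ^ 2 * (p : ℝ) ^ (-(1 + u.re)), by positivity, fun X hX => ?_⟩
  have hXp : 0 < X / p := by positivity
  set a := √(X / p) with ha
  have ha0 : 0 < a := Real.sqrt_pos.2 hXp
  have ha2 : a ^ (-2 : ℤ) = p / X := by
    rw [zpow_neg, ← inv_div]
    congr 1
    exact Real.sq_sqrt hXp.le
  have har : a ^ (-2 - 2 * u.re) = (X / p) ^ (-(1 + u.re)) := by
    rw [ha, Real.sqrt_eq_rpow, ← Real.rpow_mul hXp.le]
    congr 1
    ring
  set S := ∑' m : ℤ,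
    {m : ℤ | X < |(m : ℝ)| ∧ |(m : ℝ)| ≤ 2 * X}.indicator (fun m => ‖b m‖ₑ ^ 2) m
  have hlow : S * ENNReal.ofReal (c ^ 2) ≤
      ∑' m : ℤ, ‖b m‖ₑ ^ 2 * ‖φ (-((m : ℝ) / p) * a ^ (-2 : ℤ))‖ₑ ^ 2 := by
    rw [← ENNReal.tsum_mul_right]
    refine ENNReal.tsum_le_tsum fun m => ?_
    by_cases hm : m ∈ {m : ℤ | X < |(m : ℝ)| ∧ |(m : ℝ)| ≤ 2 * X}
    · rw [indicator_of_mem hm]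
      gcongr
      rw [ENNReal.ofReal_pow hc0.le, ← ofReal_norm]
      gcongr
      have hval : |-((m : ℝ) / p) * a ^ (-2 : ℤ)| = |(m : ℝ)| / X := by
        rw [ha2, show -((m : ℝ) / p) * (p / X) = -(m / X) by field_simp, abs_neg, abs_div,
          abs_of_pos hX]
      refine hc _ ?_ ?_
      · rw [hval, one_le_div hX]
        exact hm.1.le
      · rw [hval, div_le_iff₀ hX]
        exact hm.2
    · simp [indicator_of_notMem hm]
  have hup : ENNReal.ofReal (p * a ^ (-2 - 2 * u.re)) *
      ∑' m : ℤ, ‖b m‖ₑ ^ 2 * ‖φ (-((m : ℝ) / p) * a ^ (-2 : ℤ))‖ₑ ^ 2 ≤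
        ENNReal.ofReal (M ^ 2 * p) := by
    rw [← lintegral_sq_fW hp u hb hφ ha0]
    have hM0 : 0 ≤ M := (norm_nonneg _).trans (hbdd a ha0 0)
    calc ∫⁻ t in Ioc (0 : ℝ) p, ‖fW p u b φ a t‖ₑ ^ 2
        ≤ ∫⁻ _ in Ioc (0 : ℝ) p, ENNReal.ofReal (M ^ 2) := by
          refine lintegral_mono fun t => ?_
          rw [← ofReal_norm, ← ENNReal.ofReal_pow (norm_nonneg _)]
          gcongr
          exact hbdd a ha0 t
      _ = ENNReal.ofReal (M ^ 2 * p) := by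
          rw [setLIntegral_const, Real.volume_Ioc, sub_zero, ← ENNReal.ofReal_mul (by positivity)]
  have hpos : 0 < p * a ^ (-2 - 2 * u.re) * c ^ 2 := by positivity
  have hmain : S * ENNReal.ofReal (p * a ^ (-2 - 2 * u.re) * c ^ 2) ≤
      ENNReal.ofReal (M ^ 2 * p) := by
    rw [ENNReal.ofReal_mul (by positivity), mul_left_comm]
    exact (mul_le_mul_right hlow _).trans hup
  rw [← ENNReal.le_div_iff_mul_le (Or.inl (by simpa using hpos)) (Or.inl (by finiteness)),
    ← ENNReal.ofReal_div_of_pos hpos, har] at hmain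
  refine hmain.trans_eq ?_
  congr 1
  rw [Real.div_rpow hX.le hp'.le, Real.rpow_neg hX.le, Real.rpow_neg hp'.le]
  field_simp

theorem exists_weighted_sum_bound {β : ℤ → ℝ≥0∞} (hβ : β 0 = 0) {K σ δ : ℝ} (hK : 0 ≤ K)
    (hδ : 0 < δ)
    (h : ∀ X : ℝ, 0 < X → ∑' m : ℤ, {m : ℤ | X < |(m : ℝ)| ∧ |(m : ℝ)| ≤ 2 * X}.indicator β m ≤
      ENNReal.ofReal (K * X ^ σ)) :
    ∃ K' : ℝ, 0 ≤ K' ∧ ∀ Y : ℝ, 0 < Y →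
      ∑' m : ℤ, {m : ℤ | |(m : ℝ)| ≤ Y}.indicator
          (fun m => β m * ENNReal.ofReal (|(m : ℝ)| ^ (-(σ - δ)))) m ≤
        ENNReal.ofReal (K' * Y ^ δ) := by
  set w : ℤ → ℝ≥0∞ := fun m => β m * ENNReal.ofReal (|(m : ℝ)| ^ (-(σ - δ))) with hw
  set L : ℝ := max 1 (2 ^ (-(σ - δ))) with hL
  have hL0 : 0 ≤ L := zero_le_one.trans (le_max_left _ _)
  have h2δ : (1 : ℝ) < 2 ^ δ := Real.one_lt_rpow one_lt_two hδ
  have h2δ' : (0 : ℝ) < 2 ^ δ - 1 := by linarith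
  have hblock : ∀ X : ℝ, 0 < X →
      ∑' m : ℤ, {m : ℤ | X < |(m : ℝ)| ∧ |(m : ℝ)| ≤ 2 * X}.indicator w m ≤
        ENNReal.ofReal (L * K * X ^ δ) := by
    intro X hX
    calc ∑' m : ℤ, {m : ℤ | X < |(m : ℝ)| ∧ |(m : ℝ)| ≤ 2 * X}.indicator w m
        ≤ ∑' m : ℤ, {m : ℤ | X < |(m : ℝ)| ∧ |(m : ℝ)| ≤ 2 * X}.indicator β m *
            ENNReal.ofReal (L * X ^ (-(σ - δ))) := by
          refine ENNReal.tsum_le_tsum fun m => ?_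
          by_cases hm : m ∈ {m : ℤ | X < |(m : ℝ)| ∧ |(m : ℝ)| ≤ 2 * X}
          · rw [indicator_of_mem hm, indicator_of_mem hm]
            simp only [hw]
            gcongr
            rcases le_total 0 (-(σ - δ)) with he | he
            · calc |(m : ℝ)| ^ (-(σ - δ)) ≤ (2 * X) ^ (-(σ - δ)) := by
                    gcongr
                    exact hm.2
                _ = 2 ^ (-(σ - δ)) * X ^ (-(σ - δ)) := Real.mul_rpow zero_le_two hX.le
                _ ≤ L * X ^ (-(σ - δ)) := by
                    gcongr
                    exact le_max_right _ _
            · calc |(m : ℝ)| ^ (-(σ - δ)) ≤ 1 * X ^ (-(σ - δ)) := by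
                    rw [one_mul]
                    exact Real.rpow_le_rpow_of_nonpos hX hm.1.le he
                _ ≤ L * X ^ (-(σ - δ)) := by
                    gcongr
                    exact le_max_left _ _
          · simp [indicator_of_notMem hm]
      _ ≤ ENNReal.ofReal (K * X ^ σ) * ENNReal.ofReal (L * X ^ (-(σ - δ))) := by
          rw [ENNReal.tsum_mul_right]
          gcongr
          exact h X hX
      _ = ENNReal.ofReal (L * K * X ^ δ) := by
          rw [← ENNReal.ofReal_mul (by positivity)]
          congr 1
          rw [show K * X ^ σ * (L * X ^ (-(σ - δ))) = L * K * (X ^ σ * X ^ (-(σ - δ))) by ring,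
            ← Real.rpow_add hX]
          congr 2
          ring
  refine ⟨L * K / (2 ^ δ - 1), by positivity, fun Y hY => ?_⟩
  obtain ⟨n, hn⟩ := pow_unbounded_of_one_lt Y one_lt_two
  induction n generalizing Y with
  | zero =>
    refine le_of_eq_of_le (ENNReal.tsum_eq_zero.2 fun m => ?_) zero_le
    by_cases hm : m ∈ {m : ℤ | |(m : ℝ)| ≤ Y}
    · have hm1 : |(m : ℝ)| < 1 := lt_of_le_of_lt hm (by simpa using hn)
      have hm0 : m = 0 := Int.abs_lt_one_iff.1 (by exact_mod_cast hm1)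
      rw [indicator_of_mem hm, hw, hm0]
      simp [hβ]
    · exact indicator_of_notMem hm _
  | succ n ih =>
    have hX : 0 < Y / 2 := by positivity
    have hXn : Y / 2 < 2 ^ n := by rw [pow_succ] at hn; linarith
    calc ∑' m : ℤ, {m : ℤ | |(m : ℝ)| ≤ Y}.indicator w m
        ≤ ∑' m : ℤ, ({m : ℤ | |(m : ℝ)| ≤ Y / 2}.indicator w m +
            {m : ℤ | Y / 2 < |(m : ℝ)| ∧ |(m : ℝ)| ≤ 2 * (Y / 2)}.indicator w m) := by
          refine ENNReal.tsum_le_tsum fun m => ?_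
          simp only [indicator_apply, mem_ofPred_eq, mul_div_cancel₀ Y two_ne_zero]
          rcases le_or_gt |(m : ℝ)| (Y / 2) with hm | hm
          · have : |(m : ℝ)| ≤ Y := by linarith
            simp [hm, this]
          · simp [hm, hm.not_ge]
      _ ≤ ENNReal.ofReal (L * K / (2 ^ δ - 1) * (Y / 2) ^ δ) +
            ENNReal.ofReal (L * K * (Y / 2) ^ δ) := by
          rw [ENNReal.tsum_add]
          exact add_le_add (ih _ hX hXn) (hblock _ hX)
      _ = ENNReal.ofReal (L * K / (2 ^ δ - 1) * Y ^ δ) := by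
          rw [← ENNReal.ofReal_add (by positivity) (by positivity), Real.div_rpow hY.le zero_le_two]
          congr 1
          field_simp
          ring

theorem lintegral_comp_inv_sq_le {v : ℝ} (hv : v ≠ 0) (s : ℝ) {a₁ : ℝ} (H : ℝ → ℝ≥0∞) :
    ∫⁻ a in Ioc (0 : ℝ) a₁,
        ENNReal.ofReal (a ^ (-2 * s)) * ENNReal.ofReal a⁻¹ * H (-v * a ^ (-2 : ℤ)) ≤
      ENNReal.ofReal (|v| ^ (-s) / 2) *
        ∫⁻ y in {y : ℝ | |v| ≤ |y| * a₁ ^ 2}, ENNReal.ofReal (|y| ^ (s - 1)) * H y := by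
  have hv0 : 0 < |v| := abs_pos.2 hv
  have hderiv : ∀ a ∈ Ioc (0 : ℝ) a₁, HasDerivWithinAt (fun a : ℝ => -v * a ^ (-2 : ℤ))
      (-v * (-2 * a ^ (-3 : ℤ))) (Ioc 0 a₁) a := by
    intro a ha
    have := ((hasDerivAt_zpow (-2) a (Or.inl ha.1.ne')).const_mul (-v)).hasDerivWithinAt
      (s := Ioc 0 a₁)
    norm_num at this ⊢
    exact this
  have hinj : InjOn (fun a : ℝ => -v * a ^ (-2 : ℤ)) (Ioc 0 a₁) := by
    intro x hx y hy hxy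
    have h1 := mul_left_cancel₀ (neg_ne_zero.2 hv) hxy
    rw [zpow_neg, zpow_neg, inv_inj] at h1
    exact (pow_left_inj₀ hx.1.le hy.1.le two_ne_zero).1 h1
  have himage : (fun a : ℝ => -v * a ^ (-2 : ℤ)) '' Ioc 0 a₁ ⊆
      {y : ℝ | |v| ≤ |y| * a₁ ^ 2} := by
    rintro _ ⟨a, ha, rfl⟩
    have ha2 : 0 < a ^ 2 := pow_pos ha.1 2
    have hle : a ^ 2 ≤ a₁ ^ 2 := pow_le_pow_left₀ ha.1.le ha.2 2
    simp only [mem_ofPred_eq, abs_mul, abs_neg, zpow_neg, abs_inv, abs_zpow, abs_of_pos ha.1]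
    rw [mul_assoc, zpow_ofNat, inv_mul_eq_div]
    exact le_mul_of_one_le_right hv0.le ((one_le_div ha2).2 hle)
  rw [← lintegral_const_mul' _ _ ENNReal.ofReal_ne_top]
  refine le_trans (le_of_eq ?_) (lintegral_mono_set himage)
  rw [lintegral_image_eq_lintegral_abs_deriv_mul measurableSet_Ioc hderiv hinj]
  refine setLIntegral_congr_fun measurableSet_Ioc fun a ha => ?_
  have ha0 : 0 < a := ha.1
  simp only [← mul_assoc]
  congr 1
  rw [← ENNReal.ofReal_mul (by positivity), ← ENNReal.ofReal_mul (by positivity),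
    ← ENNReal.ofReal_mul (by positivity)]
  congr 1
  have e1 : |-v * -2 * a ^ (-3 : ℤ)| = 2 * |v| * a ^ (-3 : ℝ) := by
    rw [abs_mul, abs_mul, abs_neg, abs_neg, abs_two, abs_of_pos (zpow_pos ha0 _),
      ← Real.rpow_intCast, Int.cast_neg, Int.cast_ofNat]
    ring
  have e2 : |-v * a ^ (-2 : ℤ)| = |v| * a ^ (-2 : ℝ) := by
    rw [abs_mul, abs_neg, abs_of_pos (zpow_pos ha0 _), ← Real.rpow_intCast]
    norm_num
  rw [e1, e2, Real.mul_rpow hv0.le (by positivity), ← Real.rpow_mul ha0.le,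
    ← Real.rpow_neg_one a, ← Real.rpow_add ha0]
  have e3 : |v| * |v| ^ (-s) * |v| ^ (s - 1) = 1 := by
    nth_rewrite 1 [← Real.rpow_one |v|]
    rw [← Real.rpow_add hv0, ← Real.rpow_add hv0]
    convert Real.rpow_zero _ using 2
    ring
  have e4 : a ^ (-3 : ℝ) * a ^ (-2 * (s - 1)) = a ^ (-2 * s + -1) := by
    rw [← Real.rpow_add ha0]
    congr 1
    ring
  linear_combination (-a ^ (-2 * s + -1)) * e3 - |v| * |v| ^ (-s) * |v| ^ (s - 1) * e4

/-- if for some continuous rapidly decreasing `φ`, nonvanishing away from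
`0`, the series `f_φ` is bounded, then for every `ε > 0` there is `C > 0` such that
for all `a₁ > 0` and all continuous rapidly decreasing `ψ`,
`∫₀^{a₁} ∫₀^p |f_ψ|² dt a^ε da/a ≤ C a₁^ε ∫_{|a| ≥ 1/(a₁²p)} |a|^{u₀} |ψ(a)|² da`. -/
theorem stmt11 (p : ℕ) (hp : 0 < p) (u : ℂ) (hu : u.re < 1)
    (b : ℤ → ℂ) (hb0 : b 0 = 0) (hb : PolyGrowth b)
    (φ : ℝ → ℂ) (hφc : Continuous φ) (hφ : RapidDecay φ)
    (hφne : ∀ x : ℝ, x ≠ 0 → φ x ≠ 0)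
    (M : ℝ) (hbdd : ∀ a : ℝ, 0 < a → ∀ t : ℝ, ‖fW p u b φ a t‖ ≤ M) :
    ∀ ε : ℝ, 0 < ε → ∃ C : ℝ, 0 < C ∧
      ∀ a₁ : ℝ, 0 < a₁ → ∀ ψ : ℝ → ℂ, Continuous ψ → RapidDecay ψ →
        lhsInt p u b ψ ε (Ioc (0:ℝ) a₁)
          ≤ ENNReal.ofReal (C * a₁ ^ ε) *
              (∫⁻ a in {x : ℝ | 1 / (a₁ ^ 2 * (p : ℝ)) ≤ |x|},
                ENNReal.ofReal (|a| ^ u.re) * (‖ψ a‖₊ : ℝ≥0∞) ^ 2) := by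
  intro ε hε
  have hp' : (0 : ℝ) < p := by exact_mod_cast hp
  obtain ⟨K, hK, hdyadic⟩ := exists_dyadic_bound hp hb hφc hφ hφne hbdd
  obtain ⟨K', hK', hweighted⟩ := exists_weighted_sum_bound (β := fun m => ‖b m‖ₑ ^ 2)
    (by simp [hb0]) hK (half_pos hε) hdyadic
  set s : ℝ := 1 + u.re - ε / 2 with hs
  refine ⟨p * (p ^ s / 2) * (K' * p ^ (ε / 2)) + 1, by positivity, fun a₁ ha₁ ψ hψc hψ => ?_⟩
  set W : ℝ → ℝ≥0∞ := fun y => ENNReal.ofReal (|y| ^ (s - 1)) * ‖ψ y‖ₑ ^ 2 with hW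
  have hψm := hψc.measurable
  have hWm : Measurable W := by fun_prop
  set E : Set ℝ := {x : ℝ | 1 / (a₁ ^ 2 * (p : ℝ)) ≤ |x|} with hE
  have hEm : MeasurableSet E := measurableSet_le measurable_const (by fun_prop)
  set R : ℤ → Set ℝ := fun m => {y : ℝ | |(m : ℝ) / p| ≤ |y| * a₁ ^ 2} with hR
  have hRm : ∀ m, MeasurableSet (R m) := fun m => measurableSet_le measurable_const (by fun_prop)
  have hexpand : lhsInt p u b ψ ε (Ioc (0 : ℝ) a₁) =
      ∑' m : ℤ, ENNReal.ofReal p * ‖b m‖ₑ ^ 2 * ∫⁻ a in Ioc (0 : ℝ) a₁,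
        ENNReal.ofReal (a ^ (-2 * s)) * ENNReal.ofReal a⁻¹ *
          ‖ψ (-((m : ℝ) / p) * a ^ (-2 : ℤ))‖ₑ ^ 2 := by
    simp only [← lintegral_const_mul' _ _
      (ENNReal.mul_ne_top ENNReal.ofReal_ne_top (ENNReal.pow_ne_top enorm_ne_top))]
    rw [← lintegral_tsum fun m => Measurable.aemeasurable (by fun_prop)]
    refine setLIntegral_congr_fun measurableSet_Ioc fun a ha => ?_
    have hpow : a ^ (-2 - 2 * u.re) * a ^ ε = a ^ (-2 * s) := by
      rw [← Real.rpow_add ha.1]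
      congr 1
      rw [hs]
      ring
    have hinner := lintegral_sq_fW hp u hb hψ ha.1
    simp only [enorm_eq_nnnorm] at hinner ⊢
    rw [hinner, ← ENNReal.tsum_mul_left, ← ENNReal.tsum_mul_right, ← ENNReal.tsum_mul_right]
    refine tsum_congr fun m => ?_
    rw [← hpow, ENNReal.ofReal_mul hp'.le, ENNReal.ofReal_mul (Real.rpow_nonneg ha.1.le _)]
    ring
  have hterm : ∀ m : ℤ, ENNReal.ofReal p * ‖b m‖ₑ ^ 2 * (∫⁻ a in Ioc (0 : ℝ) a₁,
        ENNReal.ofReal (a ^ (-2 * s)) * ENNReal.ofReal a⁻¹ *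
          ‖ψ (-((m : ℝ) / p) * a ^ (-2 : ℤ))‖ₑ ^ 2) ≤
      ENNReal.ofReal (p * (p ^ s / 2)) * ∫⁻ y, (R m).indicator
        (fun y => W y * (‖b m‖ₑ ^ 2 * ENNReal.ofReal (|(m : ℝ)| ^ (-s)))) y := by
    intro m
    rcases eq_or_ne m 0 with rfl | hm
    · simp [hb0]
    have hm' : (m : ℝ) / p ≠ 0 := div_ne_zero (Int.cast_ne_zero.2 hm) hp'.ne'
    have hconst : ENNReal.ofReal (|(m : ℝ) / p| ^ (-s) / 2) =
        ENNReal.ofReal (p ^ s / 2) * ENNReal.ofReal (|(m : ℝ)| ^ (-s)) := by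
      rw [← ENNReal.ofReal_mul (by positivity), abs_div, abs_of_pos hp',
        Real.div_rpow (abs_nonneg _) hp'.le, Real.rpow_neg hp'.le]
      congr 1
      field_simp
    rw [lintegral_indicator (hRm m), lintegral_mul_const _ hWm]
    calc _ ≤ ENNReal.ofReal p * ‖b m‖ₑ ^ 2 *
          (ENNReal.ofReal (|(m : ℝ) / p| ^ (-s) / 2) * ∫⁻ y in R m, W y) := by
            gcongr
            exact lintegral_comp_inv_sq_le hm' s fun y => ‖ψ y‖ₑ ^ 2
      _ = _ := by
            rw [hconst, ENNReal.ofReal_mul hp'.le]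
            ring
  have hpoint : ∀ y : ℝ, ∑' m : ℤ, (R m).indicator
        (fun y => W y * (‖b m‖ₑ ^ 2 * ENNReal.ofReal (|(m : ℝ)| ^ (-s)))) y ≤
      E.indicator (fun y => ENNReal.ofReal (K' * p ^ (ε / 2) * a₁ ^ ε) *
        (ENNReal.ofReal (|y| ^ u.re) * ‖ψ y‖ₑ ^ 2)) y := by
    intro y
    have hmem : ∀ m : ℤ, y ∈ R m ↔ |(m : ℝ)| ≤ |y| * a₁ ^ 2 * p := fun m => by
      simp only [hR, mem_ofPred_eq, abs_div, abs_of_pos hp', div_le_iff₀ hp']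
    by_cases hy : y ∈ E
    · have hy0 : 0 < |y| := lt_of_lt_of_le (by positivity) hy
      rw [indicator_of_mem hy]
      calc ∑' m : ℤ, (R m).indicator
            (fun y => W y * (‖b m‖ₑ ^ 2 * ENNReal.ofReal (|(m : ℝ)| ^ (-s)))) y
          = W y * ∑' m : ℤ, {m : ℤ | |(m : ℝ)| ≤ |y| * a₁ ^ 2 * p}.indicator
              (fun m => ‖b m‖ₑ ^ 2 * ENNReal.ofReal (|(m : ℝ)| ^ (-s))) m := by
            rw [← ENNReal.tsum_mul_left]
            refine tsum_congr fun m => ?_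
            simp only [indicator_apply, hmem, mem_ofPred_eq, mul_ite, mul_zero]
        _ ≤ W y * ENNReal.ofReal (K' * (|y| * a₁ ^ 2 * p) ^ (ε / 2)) := by
            gcongr
            exact hweighted _ (by positivity)
        _ = ENNReal.ofReal (K' * p ^ (ε / 2) * a₁ ^ ε) *
              (ENNReal.ofReal (|y| ^ u.re) * ‖ψ y‖ₑ ^ 2) := by
            have h1 : |y| ^ u.re = |y| ^ (s - 1) * |y| ^ (ε / 2) := by
              rw [← Real.rpow_add hy0]
              congr 1
              rw [hs]
              ring
            have h2 : (|y| * a₁ ^ 2 * p) ^ (ε / 2) = |y| ^ (ε / 2) * a₁ ^ ε * p ^ (ε / 2) := by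
              rw [Real.mul_rpow (by positivity) hp'.le, Real.mul_rpow hy0.le (by positivity),
                ← Real.rpow_natCast, ← Real.rpow_mul ha₁.le]
              congr 3
              push_cast
              ring
            rw [← mul_assoc, ← ENNReal.ofReal_mul (by positivity), hW, mul_right_comm,
              ← ENNReal.ofReal_mul (by positivity), h1, h2]
            congr 2
            ring
    · rw [indicator_of_notMem hy]
      refine le_of_eq (ENNReal.tsum_eq_zero.2 fun m => ?_)
      by_cases hm : y ∈ R m
      · have hlt : |(m : ℝ)| < 1 := by
          refine ((hmem m).1 hm).trans_lt ?_
          simp only [hE, mem_ofPred_eq, not_le] at hy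
          rwa [lt_div_iff₀ (by positivity), ← mul_assoc] at hy
        have hm0 : m = 0 := Int.abs_lt_one_iff.1 (by exact_mod_cast hlt)
        rw [indicator_of_mem hm]
        simp [hm0, hb0]
      · exact indicator_of_notMem hm _
  rw [hexpand]
  calc _ ≤ ∑' m : ℤ, ENNReal.ofReal (p * (p ^ s / 2)) * ∫⁻ y, (R m).indicator
        (fun y => W y * (‖b m‖ₑ ^ 2 * ENNReal.ofReal (|(m : ℝ)| ^ (-s)))) y :=
        ENNReal.tsum_le_tsum hterm
    _ = ENNReal.ofReal (p * (p ^ s / 2)) * ∫⁻ y, ∑' m : ℤ, (R m).indicator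
        (fun y => W y * (‖b m‖ₑ ^ 2 * ENNReal.ofReal (|(m : ℝ)| ^ (-s)))) y := by
        rw [ENNReal.tsum_mul_left, lintegral_tsum fun m =>
          ((hWm.mul_const _).indicator (hRm m)).aemeasurable]
    _ ≤ ENNReal.ofReal (p * (p ^ s / 2)) *
        (ENNReal.ofReal (K' * p ^ (ε / 2) * a₁ ^ ε) *
          ∫⁻ y in E, ENNReal.ofReal (|y| ^ u.re) * ‖ψ y‖ₑ ^ 2) := by
        refine mul_le_mul' le_rfl ?_
        rw [← lintegral_const_mul' _ _ ENNReal.ofReal_ne_top, ← lintegral_indicator hEm]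
        exact lintegral_mono hpoint
    _ ≤ _ := by
        rw [← mul_assoc, ← ENNReal.ofReal_mul (by positivity)]
        refine mul_le_mul' (ENNReal.ofReal_le_ofReal ?_) le_rfl
        nlinarith [Real.rpow_pos_of_pos ha₁ ε]
end
end
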